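/- For every natural number n ≥ 2, one has d(2n−3, 3) = c_n − 2·c_{n−1}. -/

import Mathlib

open Finset

/-- Step value: `true` is an up-step (+1), `false` a down-step (−1). -/
def dyckStep (b : Bool) : ℤ := if b then 1 else -1

/-- Sum of the first `k` steps of the path `w`. -/
def dyckPSum {m : ℕ} (w : Fin m → Bool) (k : ℕ) : ℤ :=
  ∑ t ∈ Finset.univ.filter (fun t : Fin m => (t : ℕ) < k), dyckStep (w t)

/-- `dyckD i j`: the number of lattice paths of length `i` from `(0,0)` to `(i,j)`
using steps `(1,1)` and `(1,-1)` that never go below the x-axis; equivalently the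
number of `±1`-lists of length `i` all of whose partial sums are nonnegative and
whose total sum is `j`. -/
def dyckD (i j : ℕ) : ℕ :=
  (Finset.univ.filter (fun w : Fin i → Bool =>
    (∀ k ≤ i, 0 ≤ dyckPSum w k) ∧ dyckPSum w i = (j : ℤ))).card

/-- Appending a step does not change the earlier partial sums. -/
theorem dyckPSum_snoc_of_le {i : ℕ} (v : Fin i → Bool) (b : Bool) {k : ℕ} (hk : k ≤ i) :
    dyckPSum (Fin.snoc v b : Fin (i + 1) → Bool) k = dyckPSum v k := by
  simp [dyckPSum, Finset.sum_filter, Fin.sum_univ_castSucc, Nat.not_lt.mpr hk]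

theorem dyckPSum_snoc_succ {i : ℕ} (v : Fin i → Bool) (b : Bool) :
    dyckPSum (Fin.snoc v b : Fin (i + 1) → Bool) (i + 1) = dyckPSum v i + dyckStep b := by
  simp [dyckPSum, Finset.sum_filter, Fin.sum_univ_castSucc]

/-- Counting paths by their last step. -/
theorem dyckD_succ (i j : ℕ) :
    dyckD (i + 1) j =
      #{v : Fin i → Bool | (∀ k ≤ i, 0 ≤ dyckPSum v k) ∧ dyckPSum v i = (j : ℤ) - 1} +
        dyckD i (j + 1) := by
  have key (v : Fin i → Bool) (b : Bool) :
      ((∀ k ≤ i + 1, 0 ≤ dyckPSum (Fin.snoc v b : Fin (i + 1) → Bool) k) ∧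
        dyckPSum (Fin.snoc v b : Fin (i + 1) → Bool) (i + 1) = (j : ℤ)) ↔
      (∀ k ≤ i, 0 ≤ dyckPSum v k) ∧ dyckPSum v i = (j : ℤ) - dyckStep b := by
    constructor
    · rintro ⟨h, hj⟩
      rw [dyckPSum_snoc_succ] at hj
      refine ⟨fun k hk => ?_, by omega⟩
      rw [← dyckPSum_snoc_of_le v b hk]
      exact h k (by omega)
    · rintro ⟨h, hj⟩
      have hs := dyckPSum_snoc_succ v b
      refine ⟨fun k hk => ?_, by omega⟩
      rcases Nat.lt_or_eq_of_le hk with hk | rfl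
      · rw [dyckPSum_snoc_of_le v b (by omega)]
        exact h k (by omega)
      · omega
  unfold dyckD
  simp only [Finset.card_filter]
  rw [← (Fin.snocEquiv (fun _ : Fin (i + 1) => Bool)).sum_comp, Fintype.sum_prod_type,
    Fintype.sum_bool]
  refine congrArg₂ _ (Finset.sum_congr rfl fun v _ => if_congr (key v true) rfl rfl)
    (Finset.sum_congr rfl fun v _ => if_congr ((key v false).trans ?_) rfl rfl)
  simp [dyckStep]

theorem dyckD_succ_zero (i : ℕ) : dyckD (i + 1) 0 = dyckD i 1 := by
  rw [dyckD_succ, Finset.card_eq_zero.mpr, zero_add]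
  refine Finset.filter_eq_empty_iff.mpr fun v _ ⟨h, hv⟩ => ?_
  have := h i le_rfl
  omega

theorem dyckD_succ_succ (i j : ℕ) :
    dyckD (i + 1) (j + 1) = dyckD i j + dyckD i (j + 2) := by
  rw [dyckD_succ]
  simp [dyckD, add_assoc]

theorem dyckD_zero_zero : dyckD 0 0 = 1 := by
  simp [dyckD, dyckPSum]

theorem dyckD_eq_zero_of_lt {i j : ℕ} (h : i < j) : dyckD i j = 0 := by
  induction i generalizing j with
  | zero =>
    refine Finset.card_eq_zero.mpr (Finset.filter_eq_empty_iff.mpr fun v _ ⟨_, hv⟩ => ?_)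
    simp [dyckPSum] at hv
    omega
  | succ i ih =>
    obtain ⟨j, rfl⟩ : ∃ l, j = l + 1 := ⟨j - 1, by omega⟩
    rw [dyckD_succ_succ, ih (by omega), ih (by omega)]

/-- The ballot formula for `dyckD`, in subtraction-free form. -/
theorem dyckD_add_choose {i j k : ℕ} (h : i = j + 2 * k) :
    dyckD i j + i.choose (j + k + 1) = i.choose k := by
  induction i generalizing j k with
  | zero =>
    obtain ⟨rfl, rfl⟩ : j = 0 ∧ k = 0 := by omega
    simp [dyckD_zero_zero]
  | succ i ih =>
    rcases j with _ | j
    · obtain ⟨k, rfl⟩ : ∃ l, k = l + 1 := ⟨k - 1, by omega⟩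
      have h₁ := ih (j := 1) (k := k) (by omega)
      rw [show 1 + k + 1 = k + 1 + 1 by omega] at h₁
      rw [dyckD_succ_zero, show 0 + (k + 1) + 1 = k + 1 + 1 by omega, Nat.choose_succ_succ',
        Nat.choose_succ_succ']
      omega
    · have h₁ := ih (j := j) (k := k) (by omega)
      rw [dyckD_succ_succ, show j + 1 + k + 1 = j + k + 1 + 1 by omega, Nat.choose_succ_succ']
      rcases k with _ | k
      · rw [dyckD_eq_zero_of_lt (by omega : i < j + 2),
          Nat.choose_eq_zero_of_lt (by omega : i < j + 0 + 1 + 1)]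
        simpa using h₁
      · have h₂ := ih (j := j + 2) (k := k) (by omega)
        rw [show j + 2 + k + 1 = j + (k + 1) + 1 + 1 by omega] at h₂
        rw [Nat.choose_succ_succ' i k]
        omega

theorem dyckD_two_mul_zero (n : ℕ) : dyckD (2 * n) 0 = catalan n := by
  have h := dyckD_add_choose (i := 2 * n) (j := 0) (k := n) (by omega)
  have hc := Nat.choose_succ_right_eq (2 * n) n
  have hcat := succ_mul_catalan_eq_centralBinom n
  rw [Nat.centralBinom_eq_two_mul_choose] at hcat
  rw [show 2 * n - n = n by omega] at hc
  rw [zero_add] at h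
  refine Nat.eq_of_mul_eq_mul_left n.succ_pos ?_
  rw [Nat.succ_eq_add_one]
  nlinarith

/-- For `n ≥ 2`, `d(2n−3, 3) = cₙ − 2·cₙ₋₁`. -/
theorem dyckD_isoline_three (n : ℕ) (hn : 2 ≤ n) :
    (dyckD (2 * n - 3) 3 : ℤ) = catalan n - 2 * catalan (n - 1) := by
  obtain ⟨m, rfl⟩ : ∃ m, n = m + 2 := ⟨n - 2, by omega⟩
  rw [← dyckD_two_mul_zero, ← dyckD_two_mul_zero, show 2 * (m + 2) - 3 = 2 * m + 1 by omega,
    show 2 * (m + 2) = 2 * m + 1 + 1 + 1 + 1 by omega,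
    show 2 * (m + 2 - 1) = 2 * m + 1 + 1 by omega]
  simp only [dyckD_succ_zero _, dyckD_succ_succ (_ + 1) 0, dyckD_succ_succ (2 * m + 1) 1]
  push_cast
  ring
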